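/- Determinism up to swapping: if P —a→ Q and P —a→ Q' for finite GR-processes of a net, then Q ≡₁* Q'. Moreover, if P ≡₁* Q —a→ Q' then there is P' with P —a→ P' ≡₁* Q'. -/

import Mathlib

/-- A place/transition net: places `S`, transitions `T`, flow relation given by
`pre t s = F(s,t)` and `post t s = F(t,s)`, and initial marking `M0`. Every
transition has a finite non-empty multiset of preplaces and a finite multiset
of postplaces. -/
structure Net where
  S : Type
  T : Type
  pre : T → S → ℕ
  post : T → S → ℕ
  M0 : S → ℕ
  pre_fin : ∀ t, (Function.support (pre t)).Finite
  pre_ne : ∀ t, ∃ s, 0 < pre t s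
  post_fin : ∀ t, (Function.support (post t)).Finite

namespace Net

/-- `•G`, the preset of a finite multiset of transitions. -/
def preStep (N : Net) (G : N.T →₀ ℕ) : N.S → ℕ := fun s => G.sum fun t n => n * N.pre t s

/-- `G•`, the postset of a finite multiset of transitions. -/
def postStep (N : Net) (G : N.T →₀ ℕ) : N.S → ℕ := fun s => G.sum fun t n => n * N.post t s

/-- `G` is enabled at marking `M` : `•G ⊆ M`. -/
def Enabled (N : Net) (M : N.S → ℕ) (G : N.T →₀ ℕ) : Prop := ∀ s, N.preStep G s ≤ M s

/-- `M —G→ M'` : the non-empty finite multiset `G` is a step from `M` to `M'`. -/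
def Step (N : Net) (M : N.S → ℕ) (G : N.T →₀ ℕ) (M' : N.S → ℕ) : Prop :=
  G ≠ 0 ∧ N.Enabled M G ∧ ∀ s, M' s = M s - N.preStep G s + N.postStep G s

/-- Firing a single transition. -/
def Fire (N : Net) (M : N.S → ℕ) (t : N.T) (M' : N.S → ℕ) : Prop :=
  N.Step M (Finsupp.single t 1) M'

/-- Markings reachable from the initial marking by firing single transitions. -/
def Reachable (N : Net) (M : N.S → ℕ) : Prop :=
  Relation.ReflTransGen (fun M₁ M₂ => ∃ t, N.Fire M₁ t M₂) N.M0 M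

/-- The finite non-empty multiset `G` is in semantic conflict at `M`. -/
def Conflict (N : Net) (M : N.S → ℕ) (G : N.T →₀ ℕ) : Prop :=
  G ≠ 0 ∧ ¬ N.Enabled M G ∧ ∀ t, 0 < G t → N.Enabled M (Finsupp.single t (G t))

def ConflictFree (N : Net) : Prop := ∀ M, N.Reachable M → ∀ G, ¬ N.Conflict M G

def BinaryConflictFree (N : Net) : Prop :=
  ∀ M, N.Reachable M → ∀ G : N.T →₀ ℕ, (G.sum fun _ n => n) = 2 → ¬ N.Conflict M G

/-- Structural conflict net: transitions occurring together in a step at a reachable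
marking have disjoint presets. -/
def StructuralConflictNet (N : Net) : Prop :=
  ∀ t u : N.T,
    (∃ M, N.Reachable M ∧ N.Enabled M (Finsupp.single t 1 + Finsupp.single u 1)) →
    ∀ s, min (N.pre t s) (N.pre u s) = 0

/-- A sufficiently large ambient type from which the places and transitions of
GR-processes of `N` are drawn. -/
def Amb (N : Net) : Type := Set (N.S ⊕ N.T ⊕ ℕ)

end Net
/-- Raw data of a (Goltz-Reisig) process over a net `N` : an occurrence net
with places `pl` and transitions `tr` (subsets of an ambient type), flow
`Fst` (place → transition) and `Fts` (transition → place), and the process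
mapping `piS`, `piT` into `N`. -/
structure RawProc (N : Net) where
  pl : Set N.Amb
  tr : Set N.Amb
  Fst : N.Amb → N.Amb → ℕ
  Fts : N.Amb → N.Amb → ℕ
  piS : N.Amb → N.S
  piT : N.Amb → N.T

namespace RawProc

variable {N : Net}

/-- The flow relation of the process (places tagged `inl`, transitions `inr`). -/
def rel (P : RawProc N) : (N.Amb ⊕ N.Amb) → (N.Amb ⊕ N.Amb) → Prop
  | Sum.inl x, Sum.inr t => 0 < P.Fst x t
  | Sum.inr t, Sum.inl x => 0 < P.Fts t x
  | _, _ => False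

/-- The causal order `ℱ⁺` of the process. -/
def causal (P : RawProc N) : (N.Amb ⊕ N.Amb) → (N.Amb ⊕ N.Amb) → Prop :=
  Relation.TransGen P.rel

/-- The initially marked places: those with empty preset. -/
def init (P : RawProc N) : Set N.Amb := {x | x ∈ P.pl ∧ ∀ t, P.Fts t x = 0}

/-- The end `P°` of the process: places with empty postset. -/
def ends (P : RawProc N) : Set N.Amb := {x | x ∈ P.pl ∧ ∀ t, P.Fst x t = 0}

/-- The marking `ĤP = π(P°)` of the underlying net reached at the end of `P`. -/
noncomputable def endMark (P : RawProc N) : N.S → ℕ :=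
  fun s => {x | x ∈ P.ends ∧ P.piS x = s}.ncard

/-- A process is finite iff its set of transitions is finite. -/
def FiniteP (P : RawProc N) : Prop := P.tr.Finite

open Classical in
/-- `swap P p q` : exchange the outgoing arcs of the places `p` and `q`. -/
noncomputable def swap (P : RawProc N) (p q : N.Amb) : RawProc N :=
  { P with Fst := fun x t => if x = p then P.Fst q t else if x = q then P.Fst p t else P.Fst x t }

end RawProc

/-- The conditions making a `RawProc` a GR-process of the net `N`. -/
structure IsProc (N : Net) (P : RawProc N) : Prop where
  fst_dom : ∀ x t, 0 < P.Fst x t → x ∈ P.pl ∧ t ∈ P.tr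
  fts_dom : ∀ t x, 0 < P.Fts t x → x ∈ P.pl ∧ t ∈ P.tr
  pre_unique : ∀ x t t', 0 < P.Fts t x → 0 < P.Fts t' x → t = t'
  pre_le_one : ∀ t x, P.Fts t x ≤ 1
  post_unique : ∀ x t t', 0 < P.Fst x t → 0 < P.Fst x t' → t = t'
  post_le_one : ∀ x t, P.Fst x t ≤ 1
  acyclic : ∀ z, ¬ P.causal z z
  finite_past : ∀ u ∈ P.tr, {t : N.Amb | P.causal (Sum.inr t) (Sum.inr u)}.Finite
  init_fin : ∀ s : N.S, {x | x ∈ P.init ∧ P.piS x = s}.Finite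
  init_marking : ∀ s : N.S, N.M0 s = {x | x ∈ P.init ∧ P.piS x = s}.ncard
  pre_fin : ∀ t ∈ P.tr, {x | 0 < P.Fst x t}.Finite
  post_fin : ∀ t ∈ P.tr, {x | 0 < P.Fts t x}.Finite
  pre_match : ∀ t ∈ P.tr, ∀ s : N.S, N.pre (P.piT t) s = ∑ᶠ x ∈ {x | P.piS x = s}, P.Fst x t
  post_match : ∀ t ∈ P.tr, ∀ s : N.S, N.post (P.piT t) s = ∑ᶠ x ∈ {x | P.piS x = s}, P.Fts t x

/-- `ProcPrefix N Q P` : `Q ≤ P`, i.e. `Q` is a prefix of the process `P`. -/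
def ProcPrefix (N : Net) (Q P : RawProc N) : Prop :=
  Q.pl ⊆ P.pl ∧ Q.tr ⊆ P.tr ∧
  (∀ x ∈ Q.pl, ∀ t ∈ Q.tr, Q.Fst x t = P.Fst x t ∧ Q.Fts t x = P.Fts t x) ∧
  (∀ x ∈ Q.pl, Q.piS x = P.piS x) ∧ (∀ t ∈ Q.tr, Q.piT t = P.piT t) ∧
  Q.init = P.init

/-- Isomorphism of processes: a bijection between places and between transitions
respecting the flow, the initial marking and the process mappings. -/
def Iso (N : Net) (P Q : RawProc N) : Prop :=
  ∃ fp ft : N.Amb → N.Amb,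
    Set.BijOn fp P.pl Q.pl ∧ Set.BijOn ft P.tr Q.tr ∧
    (∀ x ∈ P.pl, ∀ t ∈ P.tr,
      Q.Fst (fp x) (ft t) = P.Fst x t ∧ Q.Fts (ft t) (fp x) = P.Fts t x) ∧
    (∀ x ∈ P.pl, (x ∈ P.init ↔ fp x ∈ Q.init)) ∧
    (∀ x ∈ P.pl, Q.piS (fp x) = P.piS x) ∧ (∀ t ∈ P.tr, Q.piT (ft t) = P.piT t)

/-- `p` and `q` are causally unordered places with the same image, so they may be swapped. -/
def Swappable {N : Net} (P : RawProc N) (p q : N.Amb) : Prop :=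
  p ∈ P.pl ∧ q ∈ P.pl ∧ P.piS p = P.piS q ∧
  ¬ P.causal (Sum.inl p) (Sum.inl q) ∧ ¬ P.causal (Sum.inl q) (Sum.inl p)

/-- `P ∼__S Q` : `Q` is obtained from `P` by a single swap. -/
def SwapRel (N : Net) (P Q : RawProc N) : Prop :=
  ∃ p q, Swappable P p q ∧ Q = P.swap p q

/-- `P ≡₁ Q` : one-step swapping equivalence of GR-processes (swap followed by isomorphism). -/
def OneSwap (N : Net) (P Q : RawProc N) : Prop :=
  IsProc N P ∧ IsProc N Q ∧ ∃ p q, Swappable P p q ∧ Iso N (P.swap p q) Q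

/-- `P ≡₁* Q` : the reflexive-transitive closure of one-step swapping equivalence. -/
def SwapEqv (N : Net) : RawProc N → RawProc N → Prop :=
  Relation.ReflTransGen (OneSwap N)

/-- `P —a→ Q` : the process `Q` extends `P` by exactly one transition, labelled `a`. -/
def StepExt (N : Net) (P Q : RawProc N) (a : N.T) : Prop :=
  ProcPrefix N P Q ∧ ∃ t, t ∉ P.tr ∧ Q.tr = insert t P.tr ∧ Q.piT t = a

/-- `P ⊑₁^∞ Q` : every finite prefix `P''` of `P` satisfies
`P'' ≤ P' ≡₁* Q' ≤ Q` for some finite GR-processes `P'`, `Q'`. -/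
def SwapLe (N : Net) (P Q : RawProc N) : Prop :=
  ∀ P'' : RawProc N, IsProc N P'' → P''.FiniteP → ProcPrefix N P'' P →
    ∃ P' Q' : RawProc N, IsProc N P' ∧ P'.FiniteP ∧ IsProc N Q' ∧ Q'.FiniteP ∧
      ProcPrefix N P'' P' ∧ SwapEqv N P' Q' ∧ ProcPrefix N Q' Q

/-- `BDapprox N P` : the smallest set of finite GR-processes containing all finite
prefixes of `P` and closed under `≡₁` and under taking prefixes. -/
inductive BDapprox (N : Net) (P : RawProc N) : RawProc N → Prop
  | base (Q : RawProc N) : IsProc N Q → Q.FiniteP → ProcPrefix N Q P → BDapprox N P Q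
  | swapc (Q R : RawProc N) :
      BDapprox N P R → IsProc N Q → Q.FiniteP → OneSwap N Q R → BDapprox N P Q
  | prefc (Q R : RawProc N) :
      BDapprox N P R → IsProc N Q → Q.FiniteP → ProcPrefix N Q R → BDapprox N P Q

section Aux
open Classical

variable {N : Net}

theorem RawProc.swap_Fst (P : RawProc N) (p q x t : N.Amb) :
    (P.swap p q).Fst x t = P.Fst (Equiv.swap p q x) t := by
  simp only [RawProc.swap, Equiv.swap_apply_def]
  split_ifs <;> rfl

theorem finsum_count {α : Type*} (S : Set α) (f : α → ℕ) (hf : ∀ x, f x ≤ 1) :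
    ∑ᶠ x ∈ S, f x = {x | x ∈ S ∧ 0 < f x}.ncard := by
  rw [← finsum_one]
  apply finsum_congr
  intro x
  by_cases hx : x ∈ S <;> by_cases h : 0 < f x
  · have := hf x
    simp [hx, h]; omega
  · simp [hx, h]; omega
  · simp [hx]
  · simp [hx]

theorem IsProc.pre_count {P : RawProc N} (h : IsProc N P) {t : N.Amb} (ht : t ∈ P.tr) (s : N.S) :
    {x | P.piS x = s ∧ 0 < P.Fst x t}.ncard = N.pre (P.piT t) s := by
  rw [h.pre_match t ht s, finsum_count _ _ (fun x => h.post_le_one x t)]; rfl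

theorem IsProc.post_count {P : RawProc N} (h : IsProc N P) {t : N.Amb} (ht : t ∈ P.tr) (s : N.S) :
    {x | P.piS x = s ∧ 0 < P.Fts t x}.ncard = N.post (P.piT t) s := by
  rw [h.post_match t ht s, finsum_count _ _ (fun x => h.pre_le_one t x)]; rfl

theorem IsProc.fst_zero {P : RawProc N} (h : IsProc N P) {x t : N.Amb}
    (hx : ¬ (x ∈ P.pl ∧ t ∈ P.tr)) : P.Fst x t = 0 := by
  by_contra hc
  exact hx (h.fst_dom x t (Nat.pos_of_ne_zero hc))

theorem IsProc.fts_zero {P : RawProc N} (h : IsProc N P) {x t : N.Amb}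
    (hx : ¬ (x ∈ P.pl ∧ t ∈ P.tr)) : P.Fts t x = 0 := by
  by_contra hc
  exact hx (h.fts_dom t x (Nat.pos_of_ne_zero hc))

theorem exch {α β : Type*} (A A' : Set α) (hA : A.Finite) (l : α → β)
    (hc : ∀ s, {x | x ∈ A ∧ l x = s}.ncard = {x | x ∈ A' ∧ l x = s}.ncard)
    (p : α) (hp : p ∈ A) (hp' : p ∉ A') : ∃ q, q ∈ A' ∧ q ∉ A ∧ l q = l p := by
  by_contra hcon
  push Not at hcon
  have hsub : {x | x ∈ A' ∧ l x = l p} ⊆ {x | x ∈ A ∧ l x = l p} := by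
    rintro x ⟨hx, hl⟩
    refine ⟨?_, hl⟩
    by_contra hxA
    exact hcon x hx hxA hl
  have := Set.eq_of_subset_of_ncard_le hsub (hc _).le (hA.subset fun x hx => hx.1)
  have hpm : p ∈ {x | x ∈ A' ∧ l x = l p} := by rw [this]; exact ⟨hp, rfl⟩
  exact hp' hpm.1

theorem exists_bij {α α' β : Type*} [Nonempty α'] (B : Set α) (B' : Set α') (hB : B.Finite) (hB' : B'.Finite)
    (l : α → β) (l' : α' → β)
    (hc : ∀ s, {x | l x = s ∧ x ∈ B}.ncard = {x | l' x = s ∧ x ∈ B'}.ncard) :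
    ∃ g : α → α', Set.BijOn g B B' ∧ ∀ x ∈ B, l' (g x) = l x := by
  have : ∀ s, ∃ g : α → α', Set.BijOn g {x | l x = s ∧ x ∈ B} {x | l' x = s ∧ x ∈ B'} := by
    intro s
    apply (hB.subset fun x hx => hx.2).exists_bijOn_of_encard_eq
    rw [← (hB.subset fun x (hx : x ∈ {x | l x = s ∧ x ∈ B}) => hx.2).cast_ncard_eq,
      ← (hB'.subset fun x (hx : x ∈ {x | l' x = s ∧ x ∈ B'}) => hx.2).cast_ncard_eq, hc s]
  choose g hg using this
  have key : ∀ x ∈ B, l' (g (l x) x) = l x ∧ g (l x) x ∈ B' := fun x hx => (hg (l x)).mapsTo ⟨rfl, hx⟩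
  refine ⟨fun x => g (l x) x, ⟨fun x hx => (key x hx).2, ?_, ?_⟩, fun x hx => (key x hx).1⟩
  · intro x hx y hy hxy
    have hl : l x = l y := by
      rw [← (key x hx).1, ← (key y hy).1]; exact congrArg l' hxy
    refine (hg (l x)).injOn ⟨rfl, hx⟩ ⟨hl.symm, hy⟩ ?_
    simp only at hxy
    rw [hxy, hl]
  · intro y hy
    obtain ⟨x, ⟨hx1, hx2⟩, hx⟩ := (hg (l' y)).surjOn ⟨rfl, hy⟩
    refine ⟨x, hx2, ?_⟩
    simp only
    rw [hx1, hx]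

/-- Explicit description of one-transition extensions. -/
structure ExtBy (P Q : RawProc N) (t : N.Amb) : Prop where
  ht : t ∉ P.tr
  tr : Q.tr = insert t P.tr
  pl : ∀ x, x ∈ Q.pl ↔ (x ∈ P.pl ∨ 0 < Q.Fts t x)
  disj : ∀ x, 0 < Q.Fts t x → x ∉ P.pl
  pre : ∀ x, 0 < Q.Fst x t → x ∈ P.ends
  fst : ∀ x u, u ≠ t → Q.Fst x u = P.Fst x u
  fts : ∀ x u, u ≠ t → Q.Fts u x = P.Fts u x
  piS : ∀ x ∈ P.pl, Q.piS x = P.piS x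
  piT : ∀ u ∈ P.tr, Q.piT u = P.piT u

theorem ExtBy.init_eq {P Q : RawProc N} {t : N.Amb} (hP : IsProc N P) (h : ExtBy P Q t) :
    P.init = Q.init := by
  ext x
  constructor
  · rintro ⟨hx, h0⟩
    refine ⟨(h.pl x).2 (Or.inl hx), fun u => ?_⟩
    by_cases hu : u = t
    · subst hu
      by_contra hc
      exact h.disj x (Nat.pos_of_ne_zero hc) hx
    · rw [h.fts x u hu]; exact h0 u
  · rintro ⟨hx, h0⟩
    refine ⟨?_, fun u => ?_⟩
    · rcases (h.pl x).1 hx with h1 | h1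
      · exact h1
      · rw [h0 t] at h1; omega
    · by_cases hu : u = t
      · subst hu
        exact hP.fts_zero fun hh => h.ht hh.2
      · rw [← h.fts x u hu]; exact h0 u

theorem ExtBy.stepExt {P Q : RawProc N} {t : N.Amb} (hP : IsProc N P) (h : ExtBy P Q t) :
    StepExt N P Q (Q.piT t) := by
  refine ⟨⟨fun x hx => (h.pl x).2 (Or.inl hx), ?_, ?_, fun x hx => (h.piS x hx).symm,
    fun u hu => (h.piT u hu).symm, h.init_eq hP⟩, t, h.ht, h.tr, rfl⟩
  · rw [h.tr]; exact Set.subset_insert _ _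
  · intro x hx u hu
    have : u ≠ t := fun e => h.ht (e ▸ hu)
    exact ⟨(h.fst x u this).symm, (h.fts x u this).symm⟩

theorem extBy_of_stepExt {P Q : RawProc N} {a : N.T} (hP : IsProc N P) (hQ : IsProc N Q)
    (h : StepExt N P Q a) : ∃ t, ExtBy P Q t ∧ Q.piT t = a := by
  obtain ⟨⟨hpl, htr, hF, hS, hT, hinit⟩, t, ht, hQtr, ha⟩ := h
  have fst : ∀ x u, u ≠ t → Q.Fst x u = P.Fst x u := by
    intro x u hu
    by_cases hut : u ∈ P.tr
    · by_cases hx : x ∈ P.pl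
      · exact ((hF x hx u hut).1).symm
      · rw [hP.fst_zero fun hh => hx hh.1]
        by_contra hc
        have hc := Nat.pos_of_ne_zero hc
        have h1 := hP.pre_count hut (Q.piS x)
        have h2 := hQ.pre_count (htr hut) (Q.piS x)
        rw [← hT u hut] at h2
        have hsub : {y | P.piS y = Q.piS x ∧ 0 < P.Fst y u} ⊆ {y | Q.piS y = Q.piS x ∧ 0 < Q.Fst y u} := by
          rintro y ⟨hy1, hy2⟩
          have hy := (hP.fst_dom y u hy2).1
          exact ⟨by rw [← hS y hy]; exact hy1, by rw [← (hF y hy u hut).1]; exact hy2⟩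
        have := Set.eq_of_subset_of_ncard_le hsub (by rw [h1, h2])
          ((hQ.pre_fin u (htr hut)).subset fun y hy => hy.2)
        have hm : x ∈ {y | P.piS y = Q.piS x ∧ 0 < P.Fst y u} := by rw [this]; exact ⟨rfl, hc⟩
        exact hx (hP.fst_dom x u hm.2).1
    · rw [hP.fst_zero fun hh => hut hh.2, hQ.fst_zero]
      rintro ⟨-, hh⟩
      rw [hQtr] at hh
      exact hh.elim hu hut
  have fts : ∀ x u, u ≠ t → Q.Fts u x = P.Fts u x := by
    intro x u hu
    by_cases hut : u ∈ P.tr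
    · by_cases hx : x ∈ P.pl
      · exact ((hF x hx u hut).2).symm
      · rw [hP.fts_zero fun hh => hx hh.1]
        by_contra hc
        have hc := Nat.pos_of_ne_zero hc
        have h1 := hP.post_count hut (Q.piS x)
        have h2 := hQ.post_count (htr hut) (Q.piS x)
        rw [← hT u hut] at h2
        have hsub : {y | P.piS y = Q.piS x ∧ 0 < P.Fts u y} ⊆ {y | Q.piS y = Q.piS x ∧ 0 < Q.Fts u y} := by
          rintro y ⟨hy1, hy2⟩
          have hy := (hP.fts_dom u y hy2).1
          exact ⟨by rw [← hS y hy]; exact hy1, by rw [← (hF y hy u hut).2]; exact hy2⟩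
        have := Set.eq_of_subset_of_ncard_le hsub (by rw [h1, h2])
          ((hQ.post_fin u (htr hut)).subset fun y hy => hy.2)
        have hm : x ∈ {y | P.piS y = Q.piS x ∧ 0 < P.Fts u y} := by rw [this]; exact ⟨rfl, hc⟩
        exact hx (hP.fts_dom u x hm.2).1
    · rw [hP.fts_zero fun hh => hut hh.2, hQ.fts_zero]
      rintro ⟨-, hh⟩
      rw [hQtr] at hh
      exact hh.elim hu hut
  have disj : ∀ x, 0 < Q.Fts t x → x ∉ P.pl := by
    intro x h0 hx
    by_cases hi : x ∈ P.init
    · rw [hinit] at hi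
      have := hi.2 t
      omega
    · have : ∃ u, P.Fts u x ≠ 0 := by
        by_contra hc
        push Not at hc
        exact hi ⟨hx, hc⟩
      obtain ⟨u, hu⟩ := this
      have hu := Nat.pos_of_ne_zero hu
      have hut := (hP.fts_dom u x hu).2
      have hne : u ≠ t := fun e => ht (e ▸ hut)
      rw [← fts x u hne] at hu
      exact hne (hQ.pre_unique x u t hu h0)
  have pl : ∀ x, x ∈ Q.pl ↔ (x ∈ P.pl ∨ 0 < Q.Fts t x) := by
    intro x
    constructor
    · intro hx
      by_cases hi : x ∈ Q.init
      · rw [← hinit] at hi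
        exact Or.inl hi.1
      · have : ∃ u, Q.Fts u x ≠ 0 := by
          by_contra hc
          push Not at hc
          exact hi ⟨hx, hc⟩
        obtain ⟨u, hu⟩ := this
        have hu := Nat.pos_of_ne_zero hu
        by_cases hut : u = t
        · right; rw [← hut]; exact hu
        · left
          rw [fts x u hut] at hu
          exact (hP.fts_dom u x hu).1
    · rintro (hx | hx)
      · exact hpl hx
      · exact (hQ.fts_dom t x hx).1
  refine ⟨t, ⟨ht, hQtr, pl, disj, ?_, fst, fts, fun x hx => (hS x hx).symm,
    fun u hu => (hT u hu).symm⟩, ha⟩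
  intro x hx
  refine ⟨?_, fun u => ?_⟩
  · rcases (pl x).1 (hQ.fst_dom x t hx).1 with h1 | h1
    · exact h1
    · exfalso
      apply hQ.acyclic (Sum.inl x)
      exact Relation.TransGen.tail (Relation.TransGen.single (b := Sum.inr t) hx) h1
  · by_contra hc
    have hc := Nat.pos_of_ne_zero hc
    have hut := (hP.fst_dom x u hc).2
    have hne : u ≠ t := fun e => ht (e ▸ hut)
    rw [← fst x u hne] at hc
    exact hne (hQ.post_unique x u t hc hx)

/-- Level function: old nodes 0, new transition 1, its postplaces 2. -/
noncomputable def lev (Q : RawProc N) (t : N.Amb) : N.Amb ⊕ N.Amb → ℕ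
  | Sum.inl x => if 0 < Q.Fts t x then 2 else 0
  | Sum.inr u => if u = t then 1 else 0

theorem ExtBy.rel_lev {P Q : RawProc N} {t : N.Amb} (hP : IsProc N P) (h : ExtBy P Q t)
    (z w : N.Amb ⊕ N.Amb) (hr : Q.rel z w) :
    lev Q t z < lev Q t w ∨ (lev Q t z = lev Q t w ∧ P.rel z w) := by
  rcases z with x | u <;> rcases w with y | v
  · exact hr.elim
  · change 0 < Q.Fst x v at hr
    have hx : x ∈ P.pl := by
      by_cases hv : v = t
      · subst hv; exact (h.pre x hr).1
      · rw [h.fst x v hv] at hr; exact (hP.fst_dom x v hr).1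
    have hx' : ¬ 0 < Q.Fts t x := fun hc => h.disj x hc hx
    by_cases hv : v = t
    · left; simp only [lev, hx', hv]; simp
    · right; simp only [lev, hx', hv]
      exact ⟨by simp, by rw [h.fst x v hv] at hr; exact hr⟩
  · change 0 < Q.Fts u y at hr
    by_cases hu : u = t
    · subst hu
      left; simp [lev, hr]
    · right
      rw [h.fts y u hu] at hr
      have hy' : ¬ 0 < Q.Fts t y := fun hc => h.disj y hc (hP.fts_dom u y hr).1
      refine ⟨?_, hr⟩
      simp only [lev, hy', hu]; simp
  · exact hr.elim

theorem ExtBy.causal_lev {P Q : RawProc N} {t : N.Amb} (hP : IsProc N P) (h : ExtBy P Q t)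
    (z w : N.Amb ⊕ N.Amb) (hr : Q.causal z w) :
    lev Q t z < lev Q t w ∨ (lev Q t z = lev Q t w ∧ P.causal z w) := by
  induction hr with
  | single hr =>
    rcases h.rel_lev hP _ _ hr with h1 | ⟨h1, h2⟩
    · exact Or.inl h1
    · exact Or.inr ⟨h1, Relation.TransGen.single h2⟩
  | tail _ hr ih =>
    rcases h.rel_lev hP _ _ hr with h1 | ⟨h1, h2⟩
    · left; omega
    · rcases ih with h3 | ⟨h3, h4⟩
      · left; omega
      · exact Or.inr ⟨by omega, h4.tail h2⟩

theorem ExtBy.causal_old {P Q : RawProc N} {t : N.Amb} (hP : IsProc N P) (h : ExtBy P Q t)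
    {p q : N.Amb} (hp : p ∈ P.pl) (hq : q ∈ P.pl) (hr : Q.causal (Sum.inl p) (Sum.inl q)) :
    P.causal (Sum.inl p) (Sum.inl q) := by
  have hp' : ¬ 0 < Q.Fts t p := fun hc => h.disj p hc hp
  have hq' : ¬ 0 < Q.Fts t q := fun hc => h.disj q hc hq
  rcases h.causal_lev hP _ _ hr with h1 | h1
  · simp [lev, hp', hq'] at h1
  · exact h1.2

theorem ExtBy.swappable {P Q : RawProc N} {t : N.Amb} (hP : IsProc N P) (h : ExtBy P Q t)
    {p q : N.Amb} (hs : Swappable P p q) : Swappable Q p q := by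
  obtain ⟨hp, hq, hl, h1, h2⟩ := hs
  exact ⟨(h.pl p).2 (Or.inl hp), (h.pl q).2 (Or.inl hq), by rw [h.piS p hp, h.piS q hq, hl],
    fun hc => h1 (h.causal_old hP hp hq hc), fun hc => h2 (h.causal_old hP hq hp hc)⟩

theorem swap_mem {P : RawProc N} {p q : N.Amb} (hs : Swappable P p q) (x : N.Amb) :
    Equiv.swap p q x ∈ P.pl ↔ x ∈ P.pl := by
  obtain ⟨hp, hq, -⟩ := hs
  rw [Equiv.swap_apply_def]
  split_ifs with h1 h2
  · simp [h1, hp, hq]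
  · simp [h2, hp, hq]
  · rfl

theorem swap_piS {P : RawProc N} {p q : N.Amb} (hs : Swappable P p q) (x : N.Amb) :
    P.piS (Equiv.swap p q x) = P.piS x := by
  obtain ⟨hp, hq, hl, -⟩ := hs
  rw [Equiv.swap_apply_def]
  split_ifs with h1 h2
  · rw [h1, hl]
  · rw [h2, hl]
  · rfl

theorem causal_swap {P : RawProc N} (hP : IsProc N P) {p q : N.Amb} (hs : Swappable P p q)
    (z w : N.Amb ⊕ N.Amb) (h : (P.swap p q).causal z w) :
    P.causal z w ∨
    (Relation.ReflTransGen P.rel z (Sum.inl p) ∧ P.causal (Sum.inl q) w) ∨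
    (Relation.ReflTransGen P.rel z (Sum.inl q) ∧ P.causal (Sum.inl p) w) := by
  obtain ⟨-, -, -, h1, h2⟩ := hs
  have step : ∀ z w, (P.swap p q).rel z w → P.rel z w ∨ (z = Sum.inl p ∧ P.rel (Sum.inl q) w) ∨
      (z = Sum.inl q ∧ P.rel (Sum.inl p) w) := by
    intro z w hr
    rcases z with x | u <;> rcases w with y | v
    · exact hr.elim
    · change 0 < (P.swap p q).Fst x v at hr
      rw [RawProc.swap_Fst, Equiv.swap_apply_def] at hr
      split_ifs at hr with e1 e2
      · right; left; exact ⟨by rw [e1], hr⟩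
      · right; right; exact ⟨by rw [e2], hr⟩
      · left; exact hr
    · left; exact hr
    · exact hr.elim
  induction h with
  | single hr =>
    rcases step _ _ hr with h | ⟨h, h'⟩ | ⟨h, h'⟩
    · exact Or.inl (Relation.TransGen.single h)
    · subst h; exact Or.inr (Or.inl ⟨Relation.ReflTransGen.refl, Relation.TransGen.single h'⟩)
    · subst h; exact Or.inr (Or.inr ⟨Relation.ReflTransGen.refl, Relation.TransGen.single h'⟩)
  | tail _ hr ih =>
    rcases step _ _ hr with h | ⟨h, h'⟩ | ⟨h, h'⟩
    · rcases ih with i | ⟨i, j⟩ | ⟨i, j⟩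
      · exact Or.inl (i.tail h)
      · exact Or.inr (Or.inl ⟨i, j.tail h⟩)
      · exact Or.inr (Or.inr ⟨i, j.tail h⟩)
    · subst h
      rcases ih with i | ⟨i, j⟩ | ⟨i, j⟩
      · exact Or.inr (Or.inl ⟨i.to_reflTransGen, Relation.TransGen.single h'⟩)
      · exact (h2 j).elim
      · exact (hP.acyclic _ j).elim
    · subst h
      rcases ih with i | ⟨i, j⟩ | ⟨i, j⟩
      · exact Or.inr (Or.inr ⟨i.to_reflTransGen, Relation.TransGen.single h'⟩)
      · exact (hP.acyclic _ j).elim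
      · exact (h1 j).elim

theorem finite_past_of_finite {P : RawProc N} (hdom : ∀ t x, 0 < P.Fts t x → x ∈ P.pl ∧ t ∈ P.tr)
    (hf : P.FiniteP) (u : N.Amb) : {t : N.Amb | P.causal (Sum.inr t) (Sum.inr u)}.Finite := by
  refine Set.Finite.subset hf ?_
  intro t ht
  obtain ⟨z, hz, -⟩ := Relation.TransGen.head'_iff.1 ht
  rcases z with x | v
  · exact (hdom t x hz).2
  · exact hz.elim

theorem swap_isProc {P : RawProc N} (hP : IsProc N P) (hf : P.FiniteP) {p q : N.Amb}
    (hs : Swappable P p q) : IsProc N (P.swap p q) where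
  fst_dom := by
    intro x t h
    rw [RawProc.swap_Fst] at h
    have := hP.fst_dom _ _ h
    exact ⟨(swap_mem hs x).1 this.1, this.2⟩
  fts_dom := hP.fts_dom
  pre_unique := hP.pre_unique
  pre_le_one := hP.pre_le_one
  post_unique := by
    intro x t t' h h'
    rw [RawProc.swap_Fst] at h h'
    exact hP.post_unique _ _ _ h h'
  post_le_one := by
    intro x t
    rw [RawProc.swap_Fst]
    exact hP.post_le_one _ _
  acyclic := by
    intro z h
    rcases causal_swap hP hs z z h with h | ⟨h, h'⟩ | ⟨h, h'⟩
    · exact hP.acyclic z h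
    · exact hs.2.2.2.2 (Relation.TransGen.trans_left h' h)
    · exact hs.2.2.2.1 (Relation.TransGen.trans_left h' h)
  finite_past := fun u _ => finite_past_of_finite (P := P.swap p q) hP.fts_dom hf u
  init_fin := hP.init_fin
  init_marking := hP.init_marking
  pre_fin := by
    intro t ht
    have := (hP.pre_fin t ht).preimage (f := Equiv.swap p q) (Equiv.injective _).injOn
    refine this.subset ?_
    intro x hx
    simp only [Set.mem_ofPred_eq, RawProc.swap_Fst] at hx
    exact hx
  post_fin := hP.post_fin
  pre_match := by
    intro t ht s
    refine (hP.pre_match t ht s).trans ?_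
    symm
    refine finsum_mem_eq_of_bijOn (Equiv.swap p q) ?_ ?_
    · refine ⟨?_, (Equiv.injective _).injOn, ?_⟩
      · intro x hx
        change P.piS _ = s
        rw [swap_piS hs]; exact hx
      · intro x hx
        refine ⟨Equiv.swap p q x, ?_, by simp⟩
        change P.piS _ = s
        rw [swap_piS hs]; exact hx
    · intro x _
      exact RawProc.swap_Fst _ _ _ _ _
  post_match := hP.post_match

theorem ExtBy.swap {P Q : RawProc N} {t : N.Amb} (h : ExtBy P Q t)
    {p q : N.Amb} (hs : Swappable P p q) : ExtBy (P.swap p q) (Q.swap p q) t where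
  ht := h.ht
  tr := h.tr
  pl := h.pl
  disj := h.disj
  pre := by
    intro x hx
    rw [RawProc.swap_Fst] at hx
    have := h.pre _ hx
    refine ⟨(swap_mem hs x).1 this.1, fun u => ?_⟩
    rw [RawProc.swap_Fst]; exact this.2 u
  fst := by
    intro x u hu
    rw [RawProc.swap_Fst, RawProc.swap_Fst]; exact h.fst _ u hu
  fts := h.fts
  piS := h.piS
  piT := h.piT

theorem swap_ends {P : RawProc N} {p q : N.Amb} (hp : p ∈ P.ends) (hq : q ∈ P.ends) :
    P.swap p q = P := by
  have : (P.swap p q).Fst = P.Fst := by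
    funext x t
    rw [RawProc.swap_Fst, Equiv.swap_apply_def]
    split_ifs with h1 h2
    · rw [h1, hq.2, hp.2]
    · rw [h2, hq.2, hp.2]
    · rfl
  cases P
  simp only [RawProc.swap] at this ⊢
  congr

theorem swappable_ends {P : RawProc N} {p q : N.Amb} (hp : p ∈ P.ends) (hq : q ∈ P.ends)
    (hl : P.piS p = P.piS q) : Swappable P p q := by
  have key : ∀ x ∈ P.ends, ∀ w, ¬ P.causal (Sum.inl x) w := by
    intro x hx w h
    obtain ⟨z, hz, -⟩ := Relation.TransGen.head'_iff.1 h
    rcases z with y | v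
    · exact hz.elim
    · change 0 < P.Fst x v at hz
      rw [hx.2 v] at hz; omega
  exact ⟨hp.1, hq.1, hl, key p hp _, key q hq _⟩

theorem iso_refl (P : RawProc N) : Iso N P P :=
  ⟨id, id, Set.bijOn_id _, Set.bijOn_id _, fun _ _ _ _ => ⟨rfl, rfl⟩, fun _ _ => Iff.rfl,
    fun _ _ => rfl, fun _ _ => rfl⟩

theorem iso_ext {P Q P' Q' : RawProc N} {t t' : N.Amb} (hP : IsProc N P) (hQ : IsProc N Q)
    (hP' : IsProc N P') (hQ' : IsProc N Q') (h : ExtBy P P' t) (h' : ExtBy Q Q' t')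
    (hlab : P'.piT t = Q'.piT t') (fp ft : N.Amb → N.Amb)
    (bp : Set.BijOn fp P.pl Q.pl) (bt : Set.BijOn ft P.tr Q.tr)
    (hF : ∀ x ∈ P.pl, ∀ t ∈ P.tr,
      Q.Fst (fp x) (ft t) = P.Fst x t ∧ Q.Fts (ft t) (fp x) = P.Fts t x)
    (hI : ∀ x ∈ P.pl, (x ∈ P.init ↔ fp x ∈ Q.init))
    (hS : ∀ x ∈ P.pl, Q.piS (fp x) = P.piS x) (hT : ∀ t ∈ P.tr, Q.piT (ft t) = P.piT t)
    (hpre : ∀ x ∈ P.pl, (0 < P'.Fst x t ↔ 0 < Q'.Fst (fp x) t')) : Iso N P' Q' := by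
  have htP : t ∈ P'.tr := by rw [h.tr]; exact Set.mem_insert _ _
  have htQ : t' ∈ Q'.tr := by rw [h'.tr]; exact Set.mem_insert _ _
  haveI : Nonempty N.Amb := ⟨t⟩
  obtain ⟨g, bg, hg⟩ := exists_bij {x | 0 < P'.Fts t x} {x | 0 < Q'.Fts t' x}
    (hP'.post_fin t htP) (hQ'.post_fin t' htQ) P'.piS Q'.piS (fun s => by
      have h1 := hP'.post_count htP s
      have h2 := hQ'.post_count htQ s
      rw [← hlab, ← h1] at h2
      exact h2.symm)
  set gp : N.Amb → N.Amb := fun x => if x ∈ P.pl then fp x else g x with hgp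
  set gt : N.Amb → N.Amb := fun u => if u = t then t' else ft u with hgt
  have gp1 : ∀ x ∈ P.pl, gp x = fp x := fun x hx => by simp [hgp, hx]
  have gp2 : ∀ x, 0 < P'.Fts t x → gp x = g x := fun x hx => by simp [hgp, h.disj x hx]
  have gt1 : gt t = t' := by simp [hgt]
  have ne1 : ∀ u ∈ P.tr, u ≠ t := fun u hu e => h.ht (e ▸ hu)
  have ne2 : ∀ u ∈ Q.tr, u ≠ t' := fun u hu e => h'.ht (e ▸ hu)
  have gt2 : ∀ u ∈ P.tr, gt u = ft u := fun u hu => by simp [hgt, ne1 u hu]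
  have i1 := h.init_eq hP
  have i2 := h'.init_eq hQ
  have endQ : ∀ y, 0 < Q'.Fts t' y → ∀ v, Q'.Fst y v = 0 := by
    intro y hy v
    by_contra hc
    have hc := Nat.pos_of_ne_zero hc
    apply h'.disj y hy
    by_cases hv : v = t'
    · subst hv; exact (h'.pre y hc).1
    · rw [h'.fst y v hv] at hc; exact (hQ.fst_dom y v hc).1
  have endP : ∀ y, 0 < P'.Fts t y → ∀ v, P'.Fst y v = 0 := by
    intro y hy v
    by_contra hc
    have hc := Nat.pos_of_ne_zero hc
    apply h.disj y hy
    by_cases hv : v = t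
    · subst hv; exact (h.pre y hc).1
    · rw [h.fst y v hv] at hc; exact (hP.fst_dom y v hc).1
  refine ⟨gp, gt, ⟨?_, ?_, ?_⟩, ⟨?_, ?_, ?_⟩, ?_, ?_, ?_, ?_⟩
  · intro x hx
    rcases (h.pl x).1 hx with hx | hx
    · rw [gp1 x hx]; exact (h'.pl _).2 (Or.inl (bp.mapsTo hx))
    · rw [gp2 x hx]; exact (h'.pl _).2 (Or.inr (bg.mapsTo hx))
  · intro x hx y hy hxy
    rcases (h.pl x).1 hx with hx | hx <;> rcases (h.pl y).1 hy with hy | hy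
    · rw [gp1 x hx, gp1 y hy] at hxy; exact bp.injOn hx hy hxy
    · rw [gp1 x hx, gp2 y hy] at hxy
      exact (h'.disj _ (bg.mapsTo hy) (hxy ▸ bp.mapsTo hx)).elim
    · rw [gp2 x hx, gp1 y hy] at hxy
      exact (h'.disj _ (bg.mapsTo hx) (hxy ▸ bp.mapsTo hy)).elim
    · rw [gp2 x hx, gp2 y hy] at hxy; exact bg.injOn hx hy hxy
  · intro y hy
    rcases (h'.pl y).1 hy with hy | hy
    · obtain ⟨x, hx, e⟩ := bp.surjOn hy
      exact ⟨x, (h.pl x).2 (Or.inl hx), by rw [gp1 x hx, e]⟩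
    · obtain ⟨x, hx, e⟩ := bg.surjOn hy
      exact ⟨x, (h.pl x).2 (Or.inr hx), by rw [gp2 x hx, e]⟩
  · intro u hu
    rw [h.tr] at hu
    rw [h'.tr]
    rcases hu with rfl | hu
    · rw [gt1]; exact Set.mem_insert _ _
    · rw [gt2 u hu]; exact Set.mem_insert_of_mem _ (bt.mapsTo hu)
  · intro u hu v hv huv
    rw [h.tr] at hu hv
    rcases hu with rfl | hu <;> rcases hv with rfl | hv
    · rfl
    · rw [gt1, gt2 v hv] at huv
      exact (ne2 _ (bt.mapsTo hv) huv.symm).elim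
    · rw [gt1, gt2 u hu] at huv
      exact (ne2 _ (bt.mapsTo hu) huv).elim
    · rw [gt2 u hu, gt2 v hv] at huv; exact bt.injOn hu hv huv
  · intro v hv
    rw [h'.tr] at hv
    rw [h.tr]
    rcases hv with rfl | hv
    · exact ⟨t, Set.mem_insert _ _, gt1⟩
    · obtain ⟨u, hu, e⟩ := bt.surjOn hv
      exact ⟨u, Set.mem_insert_of_mem _ hu, by rw [gt2 u hu, e]⟩
  · intro x hx u hu
    rw [h.tr] at hu
    rcases hu with rfl | hu <;> rcases (h.pl x).1 hx with hx | hx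
    · rw [gt1, gp1 x hx]
      constructor
      · have a1 := hpre x hx
        have a2 := hP'.post_le_one x u
        have a3 := hQ'.post_le_one (fp x) t'
        omega
      · have a1 : ¬ 0 < P'.Fts u x := fun hc => h.disj x hc hx
        have a2 : ¬ 0 < Q'.Fts t' (fp x) := fun hc => h'.disj _ hc (bp.mapsTo hx)
        omega
    · rw [gt1, gp2 x hx, endQ _ (bg.mapsTo hx), endP _ hx]
      refine ⟨rfl, ?_⟩
      have a1 : 0 < Q'.Fts t' (g x) := bg.mapsTo hx
      have a2 := hP'.pre_le_one u x
      have a3 := hQ'.pre_le_one t' (g x)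
      omega
    · rw [gt2 u hu, gp1 x hx, h'.fst _ _ (ne2 _ (bt.mapsTo hu)), h'.fts _ _ (ne2 _ (bt.mapsTo hu)),
        h.fst _ _ (ne1 u hu), h.fts _ _ (ne1 u hu)]
      exact hF x hx u hu
    · rw [gt2 u hu, gp2 x hx, endQ _ (bg.mapsTo hx), endP _ hx,
        h'.fts _ _ (ne2 _ (bt.mapsTo hu)), h.fts _ _ (ne1 u hu),
        hP.fts_zero (fun hh => h.disj x hx hh.1),
        hQ.fts_zero (fun hh => h'.disj _ (bg.mapsTo hx) hh.1)]
      exact ⟨rfl, rfl⟩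
  · intro x hx
    rw [← i1, ← i2]
    rcases (h.pl x).1 hx with hx | hx
    · rw [gp1 x hx]; exact hI x hx
    · rw [gp2 x hx]
      exact ⟨fun hc => (h.disj x hx hc.1).elim, fun hc => (h'.disj _ (bg.mapsTo hx) hc.1).elim⟩
  · intro x hx
    rcases (h.pl x).1 hx with hx | hx
    · rw [gp1 x hx, h'.piS _ (bp.mapsTo hx), h.piS x hx]; exact hS x hx
    · rw [gp2 x hx]; exact hg x hx
  · intro u hu
    rw [h.tr] at hu
    rcases hu with rfl | hu
    · rw [gt1, hlab]
    · rw [gt2 u hu, h'.piT _ (bt.mapsTo hu), h.piT u hu]; exact hT u hu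

theorem pre_label_count {P Q : RawProc N} {t : N.Amb} (hQ : IsProc N Q) (h : ExtBy P Q t) (s : N.S) :
    {x | x ∈ {x | 0 < Q.Fst x t} ∧ P.piS x = s}.ncard = N.pre (Q.piT t) s := by
  rw [← hQ.pre_count (t := t) (by rw [h.tr]; exact Set.mem_insert _ _) s]
  congr 1
  ext x
  simp only [Set.mem_ofPred_eq]
  constructor
  · rintro ⟨h1, h2⟩
    exact ⟨by rw [h.piS x (h.pre x h1).1]; exact h2, h1⟩
  · rintro ⟨h1, h2⟩
    exact ⟨h2, by rw [← h.piS x (h.pre x h2).1]; exact h1⟩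

theorem oneSwap_swap {Q : RawProc N} (hQ : IsProc N Q) (hf : Q.FiniteP) {p q : N.Amb}
    (hs : Swappable Q p q) : OneSwap N Q (Q.swap p q) :=
  ⟨hQ, swap_isProc hQ hf hs, p, q, hs, iso_refl _⟩

theorem swap_self_eq (Q : RawProc N) (p : N.Amb) : Q.swap p p = Q := by
  have : (Q.swap p p).Fst = Q.Fst := by
    funext x t
    rw [RawProc.swap_Fst, Equiv.swap_self]; rfl
  cases Q
  simp only [RawProc.swap] at this ⊢
  congr

theorem determinism {P Q' : RawProc N} {t' : N.Amb} (hP : IsProc N P) (hQ' : IsProc N Q')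
    (hf : P.FiniteP) (h' : ExtBy P Q' t') (n : ℕ) :
    ∀ (Q : RawProc N) (t : N.Amb), IsProc N Q → ExtBy P Q t → Q.piT t = Q'.piT t' →
      ({x | 0 < Q.Fst x t} \ {x | 0 < Q'.Fst x t'}).ncard = n → SwapEqv N Q Q' := by
  induction n using Nat.strong_induction_on with
  | _ n ih =>
    intro Q t hQ h hlab hn
    have htQ : t ∈ Q.tr := by rw [h.tr]; exact Set.mem_insert _ _
    have htQ' : t' ∈ Q'.tr := by rw [h'.tr]; exact Set.mem_insert _ _
    have hQf : Q.FiniteP := by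
      unfold RawProc.FiniteP; rw [h.tr]; exact Set.Finite.insert _ hf
    have hc : ∀ s, {x | x ∈ {x | 0 < Q.Fst x t} ∧ P.piS x = s}.ncard =
        {x | x ∈ {x | 0 < Q'.Fst x t'} ∧ P.piS x = s}.ncard := fun s => by
      rw [pre_label_count hQ h, pre_label_count hQ' h', hlab]
    by_cases hex : ∃ p, 0 < Q.Fst p t ∧ ¬ 0 < Q'.Fst p t'
    · obtain ⟨p, hp, hp'⟩ := hex
      obtain ⟨q, hq', hq, hl⟩ := exch _ _ (hQ.pre_fin t htQ) P.piS hc p hp hp'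
      have hpe := h.pre p hp
      have hqe := h'.pre q hq'
      have hs : Swappable P p q := swappable_ends hpe hqe hl.symm
      have hsQ := h.swappable hP hs
      have hx := h.swap hs
      rw [swap_ends hpe hqe] at hx
      refine Relation.ReflTransGen.head (oneSwap_swap hQ hQf hsQ) ?_
      refine ih _ ?_ (Q.swap p q) t (swap_isProc hQ hQf hsQ) hx hlab rfl
      rw [← hn]
      refine Set.ncard_lt_ncard ?_ ((hQ.pre_fin t htQ).diff)
      rw [Set.ssubset_iff_of_subset]
      · refine ⟨p, ⟨hp, hp'⟩, ?_⟩
        rintro ⟨h1, -⟩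
        simp only [Set.mem_ofPred_eq, RawProc.swap_Fst, Equiv.swap_apply_left] at h1
        exact hq h1
      · rintro x ⟨h1, h2⟩
        refine ⟨?_, h2⟩
        simp only [Set.mem_ofPred_eq, RawProc.swap_Fst, Equiv.swap_apply_def] at h1
        split_ifs at h1 with e1 e2
        · exact (hq h1).elim
        · exact (h2 (e2 ▸ hq')).elim
        · exact h1
    · push Not at hex
      have hiff : ∀ x ∈ P.pl, (0 < Q.Fst x t ↔ 0 < Q'.Fst (id x) t') := by
        intro x _
        refine ⟨hex x, fun hx => ?_⟩
        by_contra hxn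
        obtain ⟨q, hq1, hq2, -⟩ := exch _ _ (hQ'.pre_fin t' htQ') P.piS (fun s => (hc s).symm) x hx hxn
        exact hq2 (hex q hq1)
      have hiso := iso_ext hP hP hQ hQ' h h' hlab id id (Set.bijOn_id _) (Set.bijOn_id _)
        (fun _ _ _ _ => ⟨rfl, rfl⟩) (fun _ _ => Iff.rfl) (fun _ _ => rfl) (fun _ _ => rfl) hiff
      obtain ⟨s, hs⟩ := N.pre_ne (Q.piT t)
      rw [← hQ.pre_count htQ s] at hs
      obtain ⟨p, hp⟩ := Set.nonempty_of_ncard_ne_zero hs.ne'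
      refine Relation.ReflTransGen.single ⟨hQ, hQ', p, p, ⟨?_, ?_, rfl, hQ.acyclic _, hQ.acyclic _⟩, ?_⟩
      · exact (hQ.fst_dom p t hp.2).1
      · exact (hQ.fst_dom p t hp.2).1
      · rw [swap_self_eq]; exact hiso

theorem compl_infinite {P : RawProc N} (hP : IsProc N P) (hf : P.FiniteP) : (P.pl)ᶜ.Infinite := by
  have fin : ∀ s, {x | x ∈ P.pl ∧ P.piS x = s}.Finite := by
    intro s
    refine ((hP.init_fin s).union (Set.Finite.biUnion hf fun t ht => hP.post_fin t ht)).subset ?_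
    rintro x ⟨hx, hs⟩
    by_cases hi : x ∈ P.init
    · exact Or.inl ⟨hi, hs⟩
    · right
      have : ∃ u, P.Fts u x ≠ 0 := by
        by_contra hc
        push Not at hc
        exact hi ⟨hx, hc⟩
      obtain ⟨u, hu⟩ := this
      have hu := Nat.pos_of_ne_zero hu
      exact Set.mem_biUnion (hP.fts_dom u x hu).2 hu
  intro hcf
  have e : (Set.univ : Set N.Amb) = ⋃ o : Option N.S,
      (match o with | none => (P.pl)ᶜ | some s => {x | x ∈ P.pl ∧ P.piS x = s}) := by
    ext x
    simp only [Set.mem_univ, Set.mem_iUnion, true_iff]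
    by_cases hx : x ∈ P.pl
    · exact ⟨some (P.piS x), hx, rfl⟩
    · exact ⟨none, hx⟩
  have h1 : Cardinal.mk N.Amb ≤ Cardinal.mk (Option N.S) * Cardinal.aleph0 := by
    rw [← Cardinal.mk_univ, e]
    refine (Cardinal.mk_iUnion_le _).trans ?_
    refine mul_le_mul_right ?_ _
    refine ciSup_le' ?_
    rintro (_ | s)
    · exact (Cardinal.lt_aleph0_iff_set_finite.2 hcf).le
    · exact (Cardinal.lt_aleph0_iff_set_finite.2 (fin s)).le
  have h2 : Cardinal.mk N.Amb = 2 ^ Cardinal.mk (N.S ⊕ N.T ⊕ ℕ) := Cardinal.mk_set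
  have h3 := Cardinal.cantor (Cardinal.mk (N.S ⊕ N.T ⊕ ℕ))
  have h4 : Cardinal.aleph0 ≤ Cardinal.mk (N.S ⊕ N.T ⊕ ℕ) := Cardinal.aleph0_le_mk _
  have h5 : Cardinal.mk (Option N.S) ≤ Cardinal.mk (N.S ⊕ N.T ⊕ ℕ) := by
    refine Cardinal.mk_le_of_injective
      (f := fun o => match o with | none => Sum.inr (Sum.inr 0) | some s => Sum.inl s) ?_
    rintro (_ | a) (_ | b) hab <;> simp_all
  have h6 : Cardinal.mk (Option N.S) * Cardinal.aleph0 ≤ Cardinal.mk (N.S ⊕ N.T ⊕ ℕ) :=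
    (mul_le_mul' h5 h4).trans (Cardinal.mul_eq_self h4).le
  rw [h2] at h1
  exact absurd (h1.trans h6) (not_le.2 h3)

/-- Explicit extension of a process by a transition `t` labelled `a`. -/
noncomputable def mkExt (P : RawProc N) (t : N.Amb) (a : N.T) (A B : Set N.Amb) (l : N.Amb → N.S) :
    RawProc N where
  pl := P.pl ∪ B
  tr := insert t P.tr
  Fst := fun x u => if u = t then (if x ∈ A then 1 else 0) else P.Fst x u
  Fts := fun u x => if u = t then (if x ∈ B then 1 else 0) else P.Fts u x
  piS := fun x => if x ∈ B then l x else P.piS x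
  piT := fun u => if u = t then a else P.piT u

theorem mkExt_extBy {P : RawProc N} {t : N.Amb} {a : N.T} {A B : Set N.Amb} {l : N.Amb → N.S}
    (ht : t ∉ P.tr) (hA : A ⊆ P.ends) (hB : ∀ x ∈ B, x ∉ P.pl) :
    ExtBy P (mkExt P t a A B l) t where
  ht := ht
  tr := rfl
  pl := by intro x; by_cases hx : x ∈ B <;> simp [mkExt, hx]
  disj := by
    intro x hx
    apply hB
    by_contra hc
    simp [mkExt, hc] at hx
  pre := by
    intro x hx
    apply hA
    by_contra hc
    simp [mkExt, hc] at hx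
  fst := by intro x u hu; simp [mkExt, hu]
  fts := by intro x u hu; simp [mkExt, hu]
  piS := by
    intro x hx
    have : x ∉ B := fun hc => hB x hc hx
    simp [mkExt, this]
  piT := by
    intro u hu
    have : u ≠ t := fun e => ht (e ▸ hu)
    simp [mkExt, this]

theorem mkExt_isProc {P : RawProc N} (hP : IsProc N P) (hf : P.FiniteP)
    {t : N.Amb} {a : N.T} {A B : Set N.Amb} {l : N.Amb → N.S}
    (ht : t ∉ P.tr) (hA : A ⊆ P.ends) (hB : ∀ x ∈ B, x ∉ P.pl) (fA : A.Finite) (fB : B.Finite)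
    (cA : ∀ s, {x | P.piS x = s ∧ x ∈ A}.ncard = N.pre a s)
    (cB : ∀ s, {x | l x = s ∧ x ∈ B}.ncard = N.post a s) :
    IsProc N (mkExt P t a A B l) := by
  have h := mkExt_extBy (a := a) (l := l) ht hA hB
  have hQ : ∀ x, (mkExt P t a A B l).Fst x t = if x ∈ A then 1 else 0 := by intro x; simp [mkExt]
  have hR : ∀ x, (mkExt P t a A B l).Fts t x = if x ∈ B then 1 else 0 := by intro x; simp [mkExt]
  have hT : (mkExt P t a A B l).piT t = a := by simp [mkExt]
  have hSB : ∀ x ∈ B, (mkExt P t a A B l).piS x = l x := by intro x hx; simp [mkExt, hx]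
  have hin := h.init_eq hP
  generalize mkExt P t a A B l = Q at *
  have hQ' : ∀ x, 0 < Q.Fst x t ↔ x ∈ A := by intro x; rw [hQ]; split_ifs with hx <;> simp [hx]
  have hR' : ∀ x, 0 < Q.Fts t x ↔ x ∈ B := by intro x; rw [hR]; split_ifs with hx <;> simp [hx]
  have lQ : ∀ x u, Q.Fst x u ≤ 1 := by
    intro x u
    by_cases hu : u = t
    · subst hu; rw [hQ]; split_ifs <;> simp
    · rw [h.fst x u hu]; exact hP.post_le_one x u
  have lR : ∀ u x, Q.Fts u x ≤ 1 := by
    intro u x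
    by_cases hu : u = t
    · subst hu; rw [hR]; split_ifs <;> simp
    · rw [h.fts x u hu]; exact hP.pre_le_one u x
  have dom : ∀ u x, 0 < Q.Fts u x → x ∈ Q.pl ∧ u ∈ Q.tr := by
    intro u x hx
    rw [h.pl, h.tr]
    by_cases hu : u = t
    · subst hu; exact ⟨Or.inr hx, Set.mem_insert _ _⟩
    · rw [h.fts x u hu] at hx
      have := hP.fts_dom u x hx
      exact ⟨Or.inl this.1, Set.mem_insert_of_mem _ this.2⟩
  have hinS : ∀ s, {x | x ∈ Q.init ∧ Q.piS x = s} = {x | x ∈ P.init ∧ P.piS x = s} := by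
    intro s
    ext x
    simp only [Set.mem_ofPred_eq]
    rw [← hin]
    refine and_congr_right fun hx => ?_
    rw [h.piS x hx.1]
  have htr : ∀ u, u ∈ Q.tr → u = t ∨ (u ≠ t ∧ u ∈ P.tr) := by
    intro u hu
    by_cases e : u = t
    · exact Or.inl e
    · rw [h.tr] at hu; exact Or.inr ⟨e, hu.resolve_left e⟩
  refine ⟨?_, dom, ?_, lR, ?_, lQ, ?_, ?_, ?_, ?_, ?_, ?_, ?_, ?_⟩
  · intro x u hx
    rw [h.pl, h.tr]
    by_cases hu : u = t
    · subst hu; exact ⟨Or.inl (h.pre x hx).1, Set.mem_insert _ _⟩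
    · rw [h.fst x u hu] at hx
      have := hP.fst_dom x u hx
      exact ⟨Or.inl this.1, Set.mem_insert_of_mem _ this.2⟩
  · intro x u v hu hv
    by_cases eu : u = t <;> by_cases ev : v = t
    · rw [eu, ev]
    · subst eu
      rw [h.fts x v ev] at hv
      exact (h.disj x hu (hP.fts_dom v x hv).1).elim
    · subst ev
      rw [h.fts x u eu] at hu
      exact (h.disj x hv (hP.fts_dom u x hu).1).elim
    · rw [h.fts x u eu] at hu
      rw [h.fts x v ev] at hv
      exact hP.pre_unique x u v hu hv
  · intro x u v hu hv
    by_cases eu : u = t <;> by_cases ev : v = t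
    · rw [eu, ev]
    · subst eu
      rw [h.fst x v ev, (h.pre x hu).2 v] at hv
      omega
    · subst ev
      rw [h.fst x u eu, (h.pre x hv).2 u] at hu
      omega
    · rw [h.fst x u eu] at hu
      rw [h.fst x v ev] at hv
      exact hP.post_unique x u v hu hv
  · intro z hz
    rcases h.causal_lev hP _ _ hz with h1 | h1
    · omega
    · exact hP.acyclic z h1.2
  · intro u _
    refine finite_past_of_finite dom ?_ u
    unfold RawProc.FiniteP; rw [h.tr]; exact Set.Finite.insert _ hf
  · intro s; rw [hinS]; exact hP.init_fin s
  · intro s; rw [hinS]; exact hP.init_marking s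
  · intro u hu
    rcases htr u hu with rfl | ⟨e, hu⟩
    · exact fA.subset fun x hx => (hQ' x).1 hx
    · simp only [h.fst _ u e]; exact hP.pre_fin u hu
  · intro u hu
    rcases htr u hu with rfl | ⟨e, hu⟩
    · exact fB.subset fun x hx => (hR' x).1 hx
    · simp only [h.fts _ u e]; exact hP.post_fin u hu
  · intro u hu s
    rw [finsum_count _ _ (fun x => lQ x u)]
    rcases htr u hu with rfl | ⟨e, hu⟩
    · rw [hT, ← cA s]
      congr 1
      ext x
      simp only [Set.mem_ofPred_eq, hQ']
      exact and_congr_left fun hx => by rw [h.piS x (hA hx).1]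
    · rw [h.piT u hu, ← hP.pre_count hu s]
      congr 1
      ext x
      simp only [Set.mem_ofPred_eq, h.fst x u e]
      exact and_congr_left fun hx => by rw [h.piS x (hP.fst_dom x u hx).1]
  · intro u hu s
    rw [finsum_count _ _ (fun x => lR u x)]
    rcases htr u hu with rfl | ⟨e, hu⟩
    · rw [hT, ← cB s]
      congr 1
      ext x
      simp only [Set.mem_ofPred_eq, hR']
      exact and_congr_left fun hx => by rw [hSB x hx]
    · rw [h.piT u hu, ← hP.post_count hu s]
      congr 1
      ext x
      simp only [Set.mem_ofPred_eq, h.fts x u e]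
      exact and_congr_left fun hx => by rw [h.piS x (hP.fts_dom u x hx).1]

theorem ncard_of_bijOn {α α' β : Type*} {B : Set α} {B' : Set α'} {g : α → α'} (bg : Set.BijOn g B B')
    (l : α → β) (l' : α' → β) (hl : ∀ x ∈ B, l' (g x) = l x) (s : β) :
    {x | l x = s ∧ x ∈ B}.ncard = {x | l' x = s ∧ x ∈ B'}.ncard := by
  have : {x | l' x = s ∧ x ∈ B'} = g '' {x | l x = s ∧ x ∈ B} := by
    ext y
    constructor
    · rintro ⟨h1, h2⟩
      obtain ⟨x, hx, rfl⟩ := bg.surjOn h2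
      exact ⟨x, ⟨by rw [← hl x hx]; exact h1, hx⟩, rfl⟩
    · rintro ⟨x, ⟨h1, h2⟩, rfl⟩
      exact ⟨by rw [hl x h2]; exact h1, bg.mapsTo h2⟩
  rw [this, Set.ncard_image_of_injOn (bg.injOn.mono fun x hx => hx.2)]

theorem one_step {P Q Q' : RawProc N} {t' : N.Amb} (hf : P.FiniteP) (h1 : OneSwap N P Q)
    (hQ' : IsProc N Q') (h' : ExtBy Q Q' t') :
    ∃ P' t, IsProc N P' ∧ ExtBy P P' t ∧ P'.piT t = Q'.piT t' ∧ OneSwap N P' Q' := by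
  obtain ⟨hP, hQ, p, q, hs, fp, ft, bp, bt, hF, hI, hS, hT⟩ := h1
  have htQ : t' ∈ Q'.tr := by rw [h'.tr]; exact Set.mem_insert _ _
  have hinf := compl_infinite hP hf
  haveI : Infinite N.Amb := hinf.to_subtype.of_injective _ Subtype.val_injective
  obtain ⟨t, ht⟩ := hf.exists_notMem
  have fB' := hQ'.post_fin t' htQ
  obtain ⟨B, hBsub, hBf, hBc⟩ := hinf.exists_subset_ncard_eq {x | 0 < Q'.Fts t' x}.ncard
  obtain ⟨g, bg⟩ : ∃ g, Set.BijOn g B {x | 0 < Q'.Fts t' x} := by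
    apply hBf.exists_bijOn_of_encard_eq
    rw [← hBf.cast_ncard_eq, ← fB'.cast_ncard_eq, hBc]
  set A : Set N.Amb := {x | x ∈ P.pl ∧ 0 < Q'.Fst (fp (Equiv.swap p q x)) t'} with hAdef
  have hA : A ⊆ P.ends := by
    rintro x ⟨hx, hx0⟩
    refine ⟨hx, fun u => ?_⟩
    by_cases hu : u ∈ P.tr
    · have e := (hF (Equiv.swap p q x) ((swap_mem hs x).2 hx) u hu).1
      rw [RawProc.swap_Fst, Equiv.swap_apply_self, (h'.pre _ hx0).2] at e
      exact e.symm
    · exact hP.fst_zero fun hh => hu hh.2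
  have bA : Set.BijOn (fun x => fp (Equiv.swap p q x)) A {y | 0 < Q'.Fst y t'} := by
    refine ⟨fun x hx => hx.2, ?_, ?_⟩
    · intro x hx y hy hxy
      exact (Equiv.swap p q).injective
        (bp.injOn ((swap_mem hs x).2 hx.1) ((swap_mem hs y).2 hy.1) hxy)
    · intro y hy
      obtain ⟨x, hx, e⟩ := bp.surjOn (h'.pre y hy).1
      refine ⟨Equiv.swap p q x, ⟨(swap_mem hs x).2 hx, ?_⟩, ?_⟩
      · rw [Equiv.swap_apply_self, e]; exact hy
      · simp only [Equiv.swap_apply_self]; exact e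
  have lA : ∀ x ∈ A, Q'.piS (fp (Equiv.swap p q x)) = P.piS x := by
    intro x hx
    have hm := (swap_mem hs x).2 hx.1
    rw [h'.piS _ (bp.mapsTo hm), hS _ hm]
    exact swap_piS hs x
  have fA : A.Finite := bA.finite_iff_finite.2 (hQ'.pre_fin t' htQ)
  have hBd : ∀ x ∈ B, x ∉ P.pl := fun x hx => hBsub hx
  have hext := mkExt_extBy (a := Q'.piT t') (l := fun x => Q'.piS (g x)) ht hA hBd
  have hproc := mkExt_isProc (a := Q'.piT t') (l := fun x => Q'.piS (g x)) hP hf ht hA hBd fA hBf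
    (fun s => by
      rw [ncard_of_bijOn bA P.piS Q'.piS lA s]; exact hQ'.pre_count htQ s)
    (fun s => by
      rw [ncard_of_bijOn bg _ Q'.piS (fun x _ => rfl) s]; exact hQ'.post_count htQ s)
  have hlab : (mkExt P t (Q'.piT t') A B fun x => Q'.piS (g x)).piT t = Q'.piT t' := by simp [mkExt]
  have hpre : ∀ x, 0 < (mkExt P t (Q'.piT t') A B fun x => Q'.piS (g x)).Fst x t ↔ x ∈ A := by
    intro x
    by_cases hx : x ∈ A <;> simp [mkExt, hx]
  generalize (mkExt P t (Q'.piT t') A B fun x => Q'.piS (g x)) = P' at *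
  refine ⟨P', t, hproc, hext, hlab, hproc, hQ', p, q, hext.swappable hP hs, ?_⟩
  have hf' : P'.FiniteP := by
    unfold RawProc.FiniteP; rw [hext.tr]; exact Set.Finite.insert _ hf
  refine iso_ext (swap_isProc hP hf hs) hQ (swap_isProc hproc hf' (hext.swappable hP hs)) hQ'
    (hext.swap hs) h' hlab fp ft bp bt hF hI hS hT ?_
  intro x hx
  have hx : x ∈ P.pl := hx
  rw [RawProc.swap_Fst, hpre]
  simp only [hAdef, Set.mem_ofPred_eq, Equiv.swap_apply_self, swap_mem hs x, hx, true_and]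

theorem many_step {P Q Q' : RawProc N} {t' : N.Amb} (hPQ : SwapEqv N P Q) (hP : IsProc N P)
    (hf : P.FiniteP) (hQ' : IsProc N Q') (h' : ExtBy Q Q' t') :
    ∃ P' t, IsProc N P' ∧ ExtBy P P' t ∧ P'.piT t = Q'.piT t' ∧ SwapEqv N P' Q' := by
  induction hPQ using Relation.ReflTransGen.head_induction_on with
  | refl => exact ⟨Q', t', hQ', h', rfl, Relation.ReflTransGen.refl⟩
  | head h1 _ ih =>
    have hf1 := hf
    obtain ⟨-, hC, p, q, -, fp, ft, -, bt, -⟩ := id h1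
    obtain ⟨R', u, hR', hu, hl, he⟩ := ih hC (bt.finite_iff_finite.1 hf)
    obtain ⟨P', t, a1, a2, a3, a4⟩ := one_step hf h1 hR' hu
    exact ⟨P', t, a1, a2, a3.trans hl, Relation.ReflTransGen.head a4 he⟩

end Aux

/-- Determinism up to swapping: if `P —a→ Q` and `P —a→ Q'` then `Q ≡₁* Q'`;
moreover if `P ≡₁* Q —a→ Q'` then `P —a→ P' ≡₁* Q'` for some `P'`. -/
theorem stepExt_determinism_up_to_swapping (N : Net) :
    (∀ P Q Q' : RawProc N, ∀ a : N.T,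
      IsProc N P → IsProc N Q → IsProc N Q' → P.FiniteP →
      StepExt N P Q a → StepExt N P Q' a → SwapEqv N Q Q') ∧
    (∀ P Q Q' : RawProc N, ∀ a : N.T,
      IsProc N P → IsProc N Q → IsProc N Q' → P.FiniteP → Q.FiniteP →
      SwapEqv N P Q → StepExt N Q Q' a →
      ∃ P', IsProc N P' ∧ StepExt N P P' a ∧ SwapEqv N P' Q') := by
  constructor
  · intro P Q Q' a hP hQ hQ' hf h h'
    obtain ⟨t, ht, e⟩ := extBy_of_stepExt hP hQ h
    obtain ⟨t', ht', e'⟩ := extBy_of_stepExt hP hQ' h'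
    exact determinism hP hQ' hf ht' _ Q t hQ ht (e.trans e'.symm) rfl
  · intro P Q Q' a hP hQ hQ' hf _ hPQ h
    obtain ⟨t', ht', e'⟩ := extBy_of_stepExt hQ hQ' h
    obtain ⟨P', t, hP', ht, e, heq⟩ := many_step hPQ hP hf hQ' ht'
    refine ⟨P', hP', ?_, heq⟩
    have := ht.stepExt hP
    rwa [e, e'] at this
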